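/- arXiv:2507.21582 — 3 statements merged into one kernel-verified Lean document; each statement's English description precedes it below -/
import Mathlib

section
/- For every nonempty solid partition π one has C^π ≤ −a_{00}^π ≤ −1; in particular C^π < 0. (Note that a nonempty solid partition contains the box (0,0,0,0), so a_{00}^π ≥ 1.) -/
open scoped BigOperators

abbrev Box := ℕ × ℕ × ℕ × ℕ

def IsSolidPartition (π : Finset Box) : Prop :=
  ∀ i j k l : ℕ,
    ((i+1, j, k, l) ∈ π ∨ (i, j+1, k, l) ∈ π ∨ (i, j, k+1, l) ∈ π ∨ (i, j, k, l+1) ∈ π) →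
    (i, j, k, l) ∈ π

/-- `a_{km}^π`: the number of boxes `(p,q,u,v) ∈ π` with `p−q = k` and `u−v = m`. -/
def aCount (π : Finset Box) (k m : ℤ) : ℤ :=
  ((π.filter (fun b => (b.1 : ℤ) - (b.2.1 : ℤ) = k ∧ (b.2.2.1 : ℤ) - (b.2.2.2 : ℤ) = m)).card : ℤ)

/-- `C^π`. -/
noncomputable def Cpi (π : Finset Box) : ℤ :=
  aCount π 0 0 -
    ∑ᶠ p : ℤ × ℤ,
      (2 * (aCount π p.1 p.2) ^ 2
        - aCount π (p.1 + 1) p.2 * aCount π p.1 p.2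
        - aCount π (p.1 - 1) p.2 * aCount π p.1 p.2
        - 2 * aCount π p.1 p.2 * aCount π p.1 (p.2 - 1)
        + aCount π (p.1 + 1) p.2 * aCount π p.1 (p.2 - 1)
        + aCount π (p.1 - 1) p.2 * aCount π p.1 (p.2 - 1))

theorem finite_support_of_box {f : ℤ × ℤ → ℤ} (N : ℤ)
    (hf : ∀ k m : ℤ, (k < -N ∨ N < k ∨ m < -N ∨ N < m) → f (k, m) = 0) :
    f.HasFiniteSupport := by
  refine ((Set.finite_Icc (-N) N).prod (Set.finite_Icc (-N) N)).subset ?_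
  rintro ⟨k, m⟩ hkm
  by_contra hout
  refine hkm (hf k m ?_)
  simp only [Set.mem_prod, Set.mem_Icc] at hout
  omega

theorem finsum_shift_sub {f : ℤ × ℤ → ℤ} (hf : f.HasFiniteSupport) (e : ℤ × ℤ) :
    (fun p ↦ f (p + e) - f p).HasFiniteSupport ∧ ∑ᶠ p, (f (p + e) - f p) = 0 := by
  have hshift : (fun p ↦ f (p + e)).HasFiniteSupport :=
    Set.Finite.preimage (add_left_injective e).injOn hf
  refine ⟨(hshift.union hf).subset (Function.support_sub _ _), ?_⟩
  rw [finsum_sub_distrib hshift hf, sub_eq_zero]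
  exact finsum_comp_equiv (Equiv.addRight e)

/-- The quadratic form is half the sum of the squared mixed differences, which dominates
four times the value at the origin. -/
theorem two_mul_le_finsum (a : ℤ → ℤ → ℤ) (N : ℤ)
    (ha : ∀ k m : ℤ, (k < -N ∨ N < k ∨ m < -N ∨ N < m) → a k m = 0) :
    2 * a 0 0 ≤ ∑ᶠ p : ℤ × ℤ,
      (2 * (a p.1 p.2) ^ 2
        - a (p.1 + 1) p.2 * a p.1 p.2
        - a (p.1 - 1) p.2 * a p.1 p.2
        - 2 * a p.1 p.2 * a p.1 (p.2 - 1)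
        + a (p.1 + 1) p.2 * a p.1 (p.2 - 1)
        + a (p.1 - 1) p.2 * a p.1 (p.2 - 1)) := by
  let S : ℤ × ℤ → ℤ := fun p ↦ 2 * (a p.1 p.2) ^ 2
        - a (p.1 + 1) p.2 * a p.1 p.2
        - a (p.1 - 1) p.2 * a p.1 p.2
        - 2 * a p.1 p.2 * a p.1 (p.2 - 1)
        + a (p.1 + 1) p.2 * a p.1 (p.2 - 1)
        + a (p.1 - 1) p.2 * a p.1 (p.2 - 1)
  let s : ℤ → ℤ := fun k ↦ if 0 ≤ k then 1 else -1
  let δ : ℤ → ℤ := fun k ↦ if k = 0 then 1 else 0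
  let x : ℤ → ℤ → ℤ := fun k m ↦ a (k + 1) m - a k m
  let F : ℤ × ℤ → ℤ := fun p ↦ -2 * a p.1 p.2 ^ 2 + 2 * a (p.1 - 1) p.2 * a p.1 p.2
    + 2 * a p.1 p.2 * a p.1 (p.2 - 1) - 2 * a (p.1 - 1) p.2 * a p.1 (p.2 - 1)
    - 2 * δ p.2 * s (p.1 - 1) * a p.1 p.2
  let G : ℤ × ℤ → ℤ := fun p ↦ x p.1 (p.2 - 1) ^ 2 + s p.1 * s (p.2 - 1) * x p.1 (p.2 - 1)
  let O : ℤ × ℤ → ℤ := fun p ↦ 4 * (δ p.1 * δ p.2 * a p.1 p.2)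
  have hs : ∀ k, s k = s (k - 1) + 2 * δ k := by
    intro k
    simp only [s, δ]
    split_ifs <;> omega
  have hsq : ∀ k, s k ^ 2 = 1 := by
    intro k
    simp only [s]
    split_ifs <;> norm_num
  have key : ∀ p, O p + ((F (p + (1, 0)) - F p) + (G (p + (0, 1)) - G p)) ≤ 2 * S p := by
    rintro ⟨k, m⟩
    have hσ : (s k * s (m - 1)) ^ 2 = 1 := by rw [mul_pow, hsq, hsq, one_mul]
    have hd : s k * s (m - 1) * (x k m - x k (m - 1)) ≤ (x k m - x k (m - 1)) ^ 2 := by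
      rcases sq_eq_one_iff.mp hσ with h | h <;> rw [h]
      · nlinarith [Int.le_self_sq (x k m - x k (m - 1))]
      · nlinarith [Int.le_self_sq (-(x k m - x k (m - 1)))]
    simp only [O, F, G, S, Prod.mk_add_mk, add_zero, add_sub_cancel_right]
    rw [hs m]
    simp only [x] at *
    rw [hs k] at *
    linarith
  have hSf : S.HasFiniteSupport := by
    refine finite_support_of_box (N + 1) fun k m h ↦ ?_
    have h1 := ha k m (by omega)
    have h2 := ha k (m - 1) (by omega)
    simp [S, h1, h2]
  have hFf : F.HasFiniteSupport := by
    refine finite_support_of_box (N + 1) fun k m h ↦ ?_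
    have h1 := ha k m (by omega)
    have h2 := ha k (m - 1) (by omega)
    simp [F, h1, h2]
  have hGf : G.HasFiniteSupport := by
    refine finite_support_of_box (N + 1) fun k m h ↦ ?_
    have h1 := ha k (m - 1) (by omega)
    have h2 := ha (k + 1) (m - 1) (by omega)
    simp [G, x, h1, h2]
  have hOf : O.HasFiniteSupport := by
    refine finite_support_of_box N fun k m h ↦ ?_
    simp [O, ha k m h]
  have hO : ∑ᶠ p, O p = 4 * a 0 0 := by
    rw [finsum_eq_single O (0, 0)]
    · simp [O, δ]
    · rintro ⟨k, m⟩ hkm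
      have : k ≠ 0 ∨ m ≠ 0 := by
        by_contra! h
        exact hkm (by rw [h.1, h.2])
      rcases this with h | h <;> simp [O, δ, h]
  obtain ⟨hF1, hF2⟩ := finsum_shift_sub hFf (1, 0)
  obtain ⟨hG1, hG2⟩ := finsum_shift_sub hGf (0, 1)
  have hFG := (hF1.union hG1).subset (Function.support_add _ _)
  have hle := finsum_le_finsum' (g := fun p ↦ 2 * S p) ((hOf.union hFG).subset (Function.support_add _ _))
    (hSf.subset (Function.support_const_smul_subset 2 S)) key
  rw [finsum_add_distrib hOf hFG, finsum_add_distrib hF1 hG1, hF2, hG2, hO,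
    ← mul_finsum] at hle
  change 2 * a 0 0 ≤ ∑ᶠ p, S p
  linarith

theorem exists_aCount_box (π : Finset Box) : ∃ N : ℤ, ∀ k m : ℤ,
    (k < -N ∨ N < k ∨ m < -N ∨ N < m) → aCount π k m = 0 := by
  refine ⟨∑ b ∈ π, ((b.1 + b.2.1 + b.2.2.1 + b.2.2.2 : ℕ) : ℤ), fun k m h ↦ ?_⟩
  simp only [aCount, Nat.cast_eq_zero, Finset.card_eq_zero, Finset.filter_eq_empty_iff]
  rintro b hb ⟨h1, h2⟩
  have := Finset.single_le_sum
    (f := fun b : Box ↦ ((b.1 + b.2.1 + b.2.2.1 + b.2.2.2 : ℕ) : ℤ))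
    (fun _ _ ↦ Int.natCast_nonneg _) hb
  push_cast at this h
  omega

theorem IsSolidPartition.zero_mem {π : Finset Box} (hπ : IsSolidPartition π)
    (hne : π.Nonempty) : (0, 0, 0, 0) ∈ π := by
  obtain ⟨⟨i, j, k, l⟩, h⟩ := hne
  induction i with
  | succ i ih => exact ih (hπ _ _ _ _ (.inl h))
  | zero =>
    induction j with
    | succ j ih => exact ih (hπ _ _ _ _ (.inr (.inl h)))
    | zero =>
      induction k with
      | succ k ih => exact ih (hπ _ _ _ _ (.inr (.inr (.inl h))))
      | zero =>
        induction l with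
        | succ l ih => exact ih (hπ _ _ _ _ (.inr (.inr (.inr h))))
        | zero => exact h

/-- for every nonempty solid partition `π` one has
`C^π ≤ −a₀₀^π ≤ −1`; in particular `C^π < 0`. -/
theorem Cpi_neg (π : Finset Box) (hπ : IsSolidPartition π) (hne : π.Nonempty) :
    Cpi π ≤ -(aCount π 0 0) ∧ -(aCount π 0 0) ≤ -1 ∧ Cpi π < 0 := by
  obtain ⟨N, hN⟩ := exists_aCount_box π
  have hle := two_mul_le_finsum (aCount π) N hN
  have hpos : 1 ≤ aCount π 0 0 := by
    have : 0 < (π.filter (fun b ↦ (b.1 : ℤ) - (b.2.1 : ℤ) = 0 ∧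
        (b.2.2.1 : ℤ) - (b.2.2.2 : ℤ) = 0)).card :=
      Finset.card_pos.mpr ⟨(0, 0, 0, 0), by simp [hπ.zero_mem hne]⟩
    simp only [aCount]
    omega
  have hC : Cpi π ≤ -(aCount π 0 0) := by
    unfold Cpi
    linarith
  exact ⟨hC, by linarith, by linarith⟩
end

section
/- For every finitely supported function a : ℤ×ℤ → ℤ one has the identity Σ_{k,m∈ℤ} ( 2·a(k,m)² − a(k+1,m)·a(k,m) − a(k−1,m)·a(k,m) − 2·a(k,m)·a(k,m−1) + a(k+1,m)·a(k,m−1) + a(k−1,m)·a(k,m−1) ) = (1/2)·Σ_{k,m∈ℤ} d(k,m)², where d(k,m) := a(k,m) − a(k+1,m) − a(k,m+1) + a(k+1,m+1). (Both sums have only finitely many nonzero terms.) -/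
open scoped BigOperators

/-- the discrete mixed second difference `d(k,m) = a(k,m) − a(k+1,m) − a(k,m+1) + a(k+1,m+1)`. -/
def dd (a : ℤ × ℤ →₀ ℤ) (p : ℤ × ℤ) : ℤ :=
  a (p.1, p.2) - a (p.1 + 1, p.2) - a (p.1, p.2 + 1) + a (p.1 + 1, p.2 + 1)

theorem Function.HasFiniteSupport.comp_add_right {G M : Type*} [AddGroup G] [Zero M] {f : G → M}
    (hf : f.HasFiniteSupport) (w : G) : (fun p => f (p + w)).HasFiniteSupport :=
  hf.fun_comp_of_injective (add_left_injective w)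

theorem finsum_comp_add_right {G M : Type*} [AddGroup G] [AddCommMonoid M] (f : G → M) (w : G) :
    ∑ᶠ p, f (p + w) = ∑ᶠ p, f p :=
  finsum_comp_equiv (Equiv.addRight w)

/-- A function differing from `g` by a discrete divergence `f (p + w) - f p` has the same sum. -/
theorem finsum_add_sub_shift {G M : Type*} [AddGroup G] [AddCommGroup M] {f g : G → M}
    (hg : g.HasFiniteSupport) (hf : f.HasFiniteSupport) (w : G) :
    ∑ᶠ p, (g p + (f (p + w) - f p)) = ∑ᶠ p, g p := by
  rw [finsum_add_distrib hg ((hf.comp_add_right w).fun_sub hf),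
    finsum_sub_distrib (hf.comp_add_right w) hf, finsum_comp_add_right, sub_self, add_zero]

/-- for every finitely supported `a : ℤ×ℤ → ℤ`,
`Σ_{k,m} (2a(k,m)² − a(k+1,m)a(k,m) − a(k−1,m)a(k,m) − 2a(k,m)a(k,m−1)
  + a(k+1,m)a(k,m−1) + a(k−1,m)a(k,m−1)) = (1/2)·Σ_{k,m} d(k,m)²`. -/
theorem sum_eq_half_sum_sq (a : ℤ × ℤ →₀ ℤ) :
    ((∑ᶠ p : ℤ × ℤ,
        (2 * (a (p.1, p.2)) ^ 2
          - a (p.1 + 1, p.2) * a (p.1, p.2)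
          - a (p.1 - 1, p.2) * a (p.1, p.2)
          - 2 * a (p.1, p.2) * a (p.1, p.2 - 1)
          + a (p.1 + 1, p.2) * a (p.1, p.2 - 1)
          + a (p.1 - 1, p.2) * a (p.1, p.2 - 1)) : ℤ) : ℚ) =
      (1 / 2 : ℚ) * ((∑ᶠ p : ℤ × ℤ, (dd a p) ^ 2 : ℤ) : ℚ) := by
  have hx : (fun p : ℤ × ℤ => a p - a (p + (1, 0))).HasFiniteSupport :=
    a.hasFiniteSupport.fun_sub (a.hasFiniteSupport.comp_add_right (1, 0))
  have hd : (fun p => dd a p ^ 2).HasFiniteSupport := by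
    have h := hx.fun_sub (hx.comp_add_right (0, 1))
    convert h.fun_mul_left (fun p => dd a p) using 2 with p
    simp only [dd, Prod.add_def, add_zero]
    ring
  have hF := (hx.comp_add_right (-1, 0)).fun_mul_left (fun p => 2 * (a p - a (p + (0, -1))))
  have hG := hx.fun_mul_left
    (fun p => 2 * (a (p + (0, -1)) - a (p + (1, -1))) - (a p - a (p + (1, 0))))
  have key := finsum_add_sub_shift (hd.fun_add ((hF.comp_add_right (1, 0)).fun_sub hF)) hG (0, 1)
  rw [finsum_add_sub_shift hd hF (1, 0)] at key
  rw [eq_comm, one_div, inv_mul_eq_iff_eq_mul₀ two_ne_zero]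
  norm_cast
  rw [← key, mul_finsum]
  refine finsum_congr fun p => ?_
  simp only [dd, Prod.add_def, add_zero, ← sub_eq_add_neg]
  ring_nf
end

section
/- For every finitely supported function a : ℤ×ℤ → ℤ, with d(k,m) := a(k,m) − a(k+1,m) − a(k,m+1) + a(k+1,m+1), one has Σ_{k,m∈ℤ} d(k,m)² ≥ 4·|a(0,0)|. -/
open scoped BigOperators

/-- The sign of an integer, with `0` counted as positive. -/
def halfLineSign (k : ℤ) : ℤ := if 0 ≤ k then 1 else -1

lemma sum_halfLineSign_mul_sub (f : ℤ → ℤ) (N : ℕ) :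
    ∑ k ∈ Finset.Ico (-(N : ℤ)) N, halfLineSign k * (f k - f (k + 1)) =
      2 * f 0 - f (-N) - f N := by
  induction N with
  | zero => simp; ring
  | succ n ih =>
    have hI : Finset.Ico (-((n + 1 : ℕ) : ℤ)) ((n + 1 : ℕ) : ℤ) =
        insert (-(n : ℤ) - 1) (insert (n : ℤ) (Finset.Ico (-(n : ℤ)) n)) := by
      ext k
      simp only [Finset.mem_insert, Finset.mem_Ico]
      omega
    have h₁ : -(n : ℤ) - 1 ∉ insert (n : ℤ) (Finset.Ico (-(n : ℤ)) n) := by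
      simp only [Finset.mem_insert, Finset.mem_Ico]
      omega
    have h₂ : halfLineSign (-(n : ℤ) - 1) = -1 := if_neg (by omega)
    have h₃ : halfLineSign n = 1 := if_pos (by omega)
    rw [hI, Finset.sum_insert h₁, Finset.sum_insert (by simp), ih, h₂, h₃]
    have h₄ : -((n + 1 : ℕ) : ℤ) = -(n : ℤ) - 1 := by push_cast; ring
    rw [h₄, sub_add_cancel, Nat.cast_succ]
    ring

lemma exists_nat_box (a : ℤ × ℤ →₀ ℤ) :
    ∃ N : ℕ, ∀ k m : ℤ, (N ≤ k.natAbs ∨ N ≤ m.natAbs) → a (k, m) = 0 := by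
  refine ⟨a.support.sup (fun p => p.1.natAbs + p.2.natAbs) + 1, fun k m h => ?_⟩
  by_contra hne
  have := Finset.le_sup (f := fun p : ℤ × ℤ => p.1.natAbs + p.2.natAbs)
    (Finsupp.mem_support_iff.mpr hne)
  simp only at this
  omega

/-- `Σ_{k,m} d(k,m)² ≥ 4·|a(0,0)|`. -/
theorem sum_sq_ge (a : ℤ × ℤ →₀ ℤ) :
    (∑ᶠ p : ℤ × ℤ, (dd a p) ^ 2) ≥ 4 * |a (0, 0)| := by
  obtain ⟨N, hN⟩ := exists_nat_box a
  set I := Finset.Ico (-(N : ℤ)) N with hI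
  have hsupp : (Function.support fun p : ℤ × ℤ => (dd a p) ^ 2) ⊆ ↑(I ×ˢ I) := by
    rintro ⟨k, m⟩ hp
    by_contra hout
    simp only [hI, Finset.coe_product, Set.mem_prod, Finset.mem_coe, Finset.mem_Ico] at hout
    apply hp
    simp only [dd]
    rw [hN k m (by omega), hN (k + 1) m (by omega), hN k (m + 1) (by omega),
      hN (k + 1) (m + 1) (by omega)]
    norm_num
  have hsum : ∑ p ∈ I ×ˢ I, halfLineSign p.1 * halfLineSign p.2 * dd a p = 4 * a (0, 0) := by
    have hrow (k : ℤ) : ∑ m ∈ I, halfLineSign k * halfLineSign m * dd a (k, m) =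
        halfLineSign k * (2 * a (k, 0) - 2 * a (k + 1, 0)) := by
      have h := sum_halfLineSign_mul_sub (fun m => a (k, m) - a (k + 1, m)) N
      simp only [hN k N (by omega), hN (k + 1) N (by omega), hN k (-N) (by omega),
        hN (k + 1) (-N) (by omega)] at h
      calc _ = halfLineSign k * ∑ m ∈ I, halfLineSign m *
            (a (k, m) - a (k + 1, m) - (a (k, m + 1) - a (k + 1, m + 1))) := by
            rw [Finset.mul_sum]
            refine Finset.sum_congr rfl fun m _ => ?_
            simp only [dd]
            ring
        _ = _ := by rw [h]; ring
    rw [Finset.sum_product, Finset.sum_congr rfl fun k _ => hrow k,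
      sum_halfLineSign_mul_sub (fun k => 2 * a (k, 0)) N, hN (N : ℤ) _ (by omega),
      hN (-(N : ℤ)) _ (by omega)]
    ring
  rw [finsum_eq_sum_of_support_subset _ hsupp, ge_iff_le]
  calc 4 * |a (0, 0)| = |∑ p ∈ I ×ˢ I, halfLineSign p.1 * halfLineSign p.2 * dd a p| := by
        rw [hsum, abs_mul]; rfl
    _ ≤ ∑ p ∈ I ×ˢ I, |halfLineSign p.1 * halfLineSign p.2 * dd a p| :=
        Finset.abs_sum_le_sum_abs _ _
    _ ≤ ∑ p ∈ I ×ˢ I, (dd a p) ^ 2 := by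
        refine Finset.sum_le_sum fun p _ => ?_
        have habs (k : ℤ) : |halfLineSign k| = 1 := by
          unfold halfLineSign
          split_ifs <;> simp
        rw [abs_mul, abs_mul, habs, habs, one_mul, one_mul, ← sq_abs]
        exact Int.le_self_sq _
end
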